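/- Let Π be a projective plane of order q and let (X,Y) be an equinumerous incidence-free pair with X a set of points and Y a set of lines, and set t := q²+q+1−|X|. Then there exist chambers (P₁,ℓ₁),…,(P_t,ℓ_t) of Π such that every chamber (P,ℓ) of Π satisfies P = P_i or ℓ = ℓ_i for some i ∈ {1,…,t}. -/

import Mathlib

open Configuration

open Classical in
theorem aux_expand {P L : Type*} [Fintype P] [Fintype L] (I : P → L → Prop) (q : ℕ)
    (hjoin : ∀ p p', p ≠ p' → ∃ l, ∀ m, (I p m ∧ I p' m) ↔ m = l)
    (hdeg : ∀ p, (Finset.univ.filter fun l => I p l).card = q + 1)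
    (hL : Fintype.card L = q ^ 2 + q + 1)
    (S : Finset P) (T : Finset L) (hfree : ∀ p ∈ S, ∀ l ∈ T, ¬ I p l) :
    (T.card : ℝ) * (q + S.card) ≤ q * (q ^ 2 + q + 1 - S.card) := by
  have hTc : (Tᶜ.card : ℝ) = (q ^ 2 + q + 1 : ℝ) - T.card := by
    have := Finset.card_add_card_compl T
    rw [hL] at this
    have h2 : (T.card : ℝ) + Tᶜ.card = q ^ 2 + q + 1 := by exact_mod_cast this
    linarith
  let d : L → ℝ := fun l => ∑ p ∈ S, if I p l then 1 else 0
  have hd0 : ∀ l ∈ T, d l = 0 := fun l hl =>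
    Finset.sum_eq_zero fun p hp => by simp [hfree p hp l hl]
  have h1 : ∑ l, d l = S.card * (q + 1) := by
    simp only [d]
    rw [Finset.sum_comm]
    have : ∀ p ∈ S, ∑ l, (if I p l then (1 : ℝ) else 0) = q + 1 := by
      intro p _
      rw [Finset.sum_boole, hdeg]; push_cast; ring
    rw [Finset.sum_congr rfl this, Finset.sum_const, nsmul_eq_mul]
  have h2 : ∑ l, d l ^ 2 = S.card * (q + S.card) := by
    have e : ∀ l, d l ^ 2 = ∑ p ∈ S, ∑ p' ∈ S, if (I p l ∧ I p' l) then (1 : ℝ) else 0 := by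
      intro l
      simp only [d]
      rw [sq, Finset.sum_mul_sum]
      refine Finset.sum_congr rfl fun p _ => Finset.sum_congr rfl fun p' _ => ?_
      by_cases h : I p l <;> by_cases h' : I p' l <;> simp [h, h']
    simp_rw [e]
    rw [Finset.sum_comm]
    have : ∀ p ∈ S, ∑ l, ∑ p' ∈ S, (if (I p l ∧ I p' l) then (1 : ℝ) else 0) = q + S.card := by
      intro p hp
      rw [Finset.sum_comm]
      have : ∀ p' ∈ S, ∑ l, (if (I p l ∧ I p' l) then (1 : ℝ) else 0)
          = 1 + if p = p' then (q : ℝ) else 0 := by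
        intro p' _
        by_cases h : p = p'
        · subst h
          simp only [and_self, if_true]
          rw [Finset.sum_boole, hdeg]; push_cast; ring
        · obtain ⟨l, hl⟩ := hjoin p p' h
          simp only [hl]
          simp [h]
      rw [Finset.sum_congr rfl this, Finset.sum_add_distrib]
      simp [hp]; ring
    rw [Finset.sum_congr rfl this, Finset.sum_const, nsmul_eq_mul]
  have g1 : ∑ l ∈ Tᶜ, d l = S.card * (q + 1) := by
    rw [← h1, ← Finset.sum_add_sum_compl T, Finset.sum_eq_zero hd0, zero_add]
  have g2 : ∑ l ∈ Tᶜ, d l ^ 2 ≤ S.card * (q + S.card) := by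
    rw [← h2]
    exact Finset.sum_le_sum_of_subset_of_nonneg (Finset.subset_univ _) fun _ _ _ => sq_nonneg _
  have cs := sq_sum_le_card_mul_sum_sq (s := Tᶜ) (f := d)
  rw [g1] at cs
  have hq0 : (0 : ℝ) ≤ q := Nat.cast_nonneg _
  have hT0 : (0 : ℝ) ≤ Tᶜ.card := Nat.cast_nonneg _
  have cs2 := cs.trans (mul_le_mul_of_nonneg_left g2 hT0)
  rcases Nat.eq_zero_or_pos S.card with h0 | h0
  · rw [h0]
    push_cast
    rw [hTc] at hT0
    nlinarith
  · have hs : (0 : ℝ) < S.card := by exact_mod_cast h0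
    rw [hTc] at cs2
    have : (S.card : ℝ) * (S.card * (q + 1) ^ 2)
        ≤ S.card * ((q ^ 2 + q + 1 - T.card) * (q + S.card)) := by nlinarith
    have := le_of_mul_le_mul_left this hs
    nlinarith

theorem aux_poly (q s : ℝ) (hs : 2 ≤ s) (h : s ≤ q) :
    (q - 1 + (s - 1) ^ 2 / 4) * (q + s) ≤ s * (q ^ 2 + q + 1 - s) := by
  obtain ⟨e, rfl⟩ : ∃ e, q = s + e := ⟨q - s, by ring⟩
  have he : 0 ≤ e := by linarith
  have h1 : 0 ≤ s ^ 2 * (s - 2) := mul_nonneg (sq_nonneg _) (by linarith)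
  have h2 : 0 ≤ s * e * (7 * s - 6) := mul_nonneg (by positivity) (by linarith)
  have h3 : 0 ≤ e ^ 2 * (s - 1) := mul_nonneg (sq_nonneg _) (by linarith)
  linarith

theorem aux_arith (q s τ x a b : ℝ) (hq : 2 ≤ q) (hs : 2 ≤ s) (hsτ : s ≤ τ) (hx : 1 ≤ x)
    (ha : 0 ≤ a) (hb : 0 ≤ b) (hab : a + b ≤ s - 1) (hxab : x ≤ q - 1 + a * b)
    (h1 : x * (q + x) ≤ q * (q ^ 2 + q + 1 - x))
    (h2 : τ * (q + s) ≤ q * (q ^ 2 + q + 1 - s))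
    (h3 : q ^ 2 + q + 1 - x < s + τ) : False := by
  have hw : (x + q) ^ 2 ≤ q * (q + 1) ^ 2 := by nlinarith
  have hR : q * (q + 1) ^ 2 ≤ ((q + 1) ^ 2 / 2) ^ 2 := by
    nlinarith [mul_nonneg (sq_nonneg (q + 1)) (sq_nonneg (q - 1))]
  have hz : (s + q) ^ 2 ≤ q * (q + 1) ^ 2 := by nlinarith
  have hw' : x + q ≤ (q + 1) ^ 2 / 2 := by
    apply le_of_sq_le_sq (hw.trans hR) (by positivity)
  have hz' : s + q ≤ (q + 1) ^ 2 / 2 := by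
    apply le_of_sq_le_sq (hz.trans hR) (by positivity)
  -- x > f(s)
  have h4 : s * (q ^ 2 + q + 1 - s) < x * (q + s) := by nlinarith
  rcases le_total q s with h | h
  · nlinarith [mul_nonneg (by linarith : 0 ≤ s - q) (by linarith : 0 ≤ (q + 1) ^ 2 / 2 - (s + q)),
      mul_nonneg (by linarith : 0 ≤ s + q) (by linarith : 0 ≤ (q + 1) ^ 2 / 2 - (x + q))]
  · have hab' : a * b ≤ (s - 1) ^ 2 / 4 := by
      have := pow_le_pow_left₀ (by linarith : 0 ≤ a + b) hab 2
      linarith [sq_nonneg (a - b), (by ring : (a + b) ^ 2 = (a - b) ^ 2 + 4 * (a * b))]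
    have h5 : x * (q + s) ≤ (q - 1 + (s - 1) ^ 2 / 4) * (q + s) := by
      apply mul_le_mul_of_nonneg_right <;> linarith
    have h6 : (q - 1 + (s - 1) ^ 2 / 4) * (q + s) ≤ s * (q ^ 2 + q + 1 - s) := by
      exact aux_poly q s hs h
    linarith

open Classical in
theorem aux_main {P L : Type*} [Fintype P] [Fintype L] (I : P → L → Prop) (q : ℕ) (hq : 2 ≤ q)
    (hjoin : ∀ p p', p ≠ p' → ∃ l, ∀ m, (I p m ∧ I p' m) ↔ m = l)
    (hmeet : ∀ l l', l ≠ l' → ∃ p, ∀ r, (I r l ∧ I r l') ↔ r = p)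
    (hdeg : ∀ p, (Finset.univ.filter fun l => I p l).card = q + 1)
    (hdeg' : ∀ l, (Finset.univ.filter fun p => I p l).card = q + 1)
    (hL : Fintype.card L = q ^ 2 + q + 1)
    (X S : Finset P) (Y U T : Finset L) (hXY : ∀ p ∈ X, ∀ l ∈ Y, ¬ I p l)
    (hST : ∀ p ∈ S, ∀ l ∈ T, ¬ I p l) (hXS : Disjoint X S)
    (hcov : ∀ l, l ∈ Y ∨ l ∈ T ∨ l ∈ U)
    (hcard : X.card = Y.card) (hU : U.card < S.card)
    (hT : q ^ 2 + q + 1 < X.card + S.card + T.card) (hle : S.card ≤ T.card) : False := by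
  have e1 := aux_expand I q hjoin hdeg hL X Y hXY
  have e2 := aux_expand I q hjoin hdeg hL S T hST
  rw [← hcard] at e1
  have hqr : (2 : ℝ) ≤ q := by exact_mod_cast hq
  have hTr : (q : ℝ) ^ 2 + q + 1 < X.card + S.card + T.card := by exact_mod_cast hT
  have hler : (S.card : ℝ) ≤ T.card := by exact_mod_cast hle
  have hs1 : (1 : ℝ) ≤ S.card := by exact_mod_cast (by omega : 1 ≤ S.card)
  have key : ∀ p ∈ X, ∀ r ∈ S, ∃ l ∈ U, I p l ∧ I r l := by
    intro p hp r hr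
    have hne : p ≠ r := fun h => Finset.disjoint_left.1 hXS hp (h ▸ hr)
    obtain ⟨l, hl⟩ := hjoin p r hne
    have hl' := (hl l).2 rfl
    refine ⟨l, ?_, hl'⟩
    rcases hcov l with h | h | h
    · exact absurd hl'.1 (hXY p hp l h)
    · exact absurd hl'.2 (hST r hr l h)
    · exact h
  rcases X.eq_empty_or_nonempty with h0 | ⟨x0, hx0⟩
  · simp only [h0, Finset.card_empty, Nat.cast_zero] at hTr
    nlinarith
  · have hs2 : 2 ≤ S.card := by
      obtain ⟨r, hr⟩ := Finset.card_pos.1 (by omega : 0 < S.card)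
      obtain ⟨l, hl, _⟩ := key x0 hx0 r hr
      have := Finset.card_pos.2 ⟨l, hl⟩
      omega
    obtain ⟨r0, hr0, r1, hr1, hne⟩ := Finset.one_lt_card.1 (by omega : 1 < S.card)
    obtain ⟨l0, hl0⟩ := hjoin r0 r1 hne
    have hl0' := (hl0 l0).2 rfl
    let A := U.filter fun l => I r0 l ∧ ¬ I r1 l
    let B := U.filter fun l => I r1 l ∧ ¬ I r0 l
    have hAB : A.card + B.card ≤ U.card := by
      rw [← Finset.card_union_of_disjoint]
      · apply Finset.card_le_card
        intro l; simp only [A, B, Finset.mem_union, Finset.mem_filter]; tauto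
      · rw [Finset.disjoint_left]
        intro l; simp only [A, B, Finset.mem_filter]; tauto
    have hX1 : (X.filter fun p => I p l0).card + 2 ≤ q + 1 := by
      rw [← hdeg' l0, ← Finset.card_pair hne, ← Finset.card_union_of_disjoint]
      · apply Finset.card_le_card
        intro p
        simp only [Finset.mem_union, Finset.mem_filter, Finset.mem_insert,
          Finset.mem_singleton, Finset.mem_univ, true_and]
        rintro (h | rfl | rfl)
        · exact h.2
        · exact hl0'.1
        · exact hl0'.2
      · rw [Finset.disjoint_left]
        intro p hp
        simp only [Finset.mem_insert, Finset.mem_singleton]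
        have hpX := (Finset.mem_filter.1 hp).1
        rintro (rfl | rfl)
        · exact Finset.disjoint_left.1 hXS hpX hr0
        · exact Finset.disjoint_left.1 hXS hpX hr1
    have hX2 : (X.filter fun p => ¬ I p l0).card ≤ A.card * B.card := by
      rw [← Finset.card_product]
      haveI : Nonempty L := ⟨l0⟩
      choose! f hf using fun p (hp : p ∈ X) => key p hp r0 hr0
      choose! g hg using fun p (hp : p ∈ X) => key p hp r1 hr1
      have hA : ∀ p ∈ X.filter (fun p => ¬ I p l0), ¬ I r1 (f p) := by
        intro p hp h
        obtain ⟨hp, hn⟩ := Finset.mem_filter.1 hp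
        have := (hl0 (f p)).1 ⟨(hf p hp).2.2, h⟩
        exact hn (this ▸ (hf p hp).2.1)
      have hB : ∀ p ∈ X.filter (fun p => ¬ I p l0), ¬ I r0 (g p) := by
        intro p hp h
        obtain ⟨hp, hn⟩ := Finset.mem_filter.1 hp
        have := (hl0 (g p)).1 ⟨h, (hg p hp).2.2⟩
        exact hn (this ▸ (hg p hp).2.1)
      apply Finset.card_le_card_of_injOn (fun p => (f p, g p))
      · intro p hp
        have hp' := (Finset.mem_filter.1 hp).1
        have h1 := hA p hp
        have h2 := hB p hp
        have h3 := hf p hp'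
        have h4 := hg p hp'
        simp only [A, B, Finset.coe_product, Set.mem_prod, Finset.mem_coe, Finset.mem_filter]
        tauto
      · intro p hp p' hp' h
        simp only [Prod.mk.injEq] at h
        have hpX := (Finset.mem_filter.1 hp).1
        have hpX' := (Finset.mem_filter.1 hp').1
        have hfg : f p ≠ g p := fun h => hA p hp (h ▸ (hg p hpX).2.2)
        obtain ⟨c, hc⟩ := hmeet _ _ hfg
        rw [(hc p).1 ⟨(hf p hpX).2.1, (hg p hpX).2.1⟩]
        refine ((hc p').1 ⟨?_, ?_⟩).symm
        · rw [h.1]; exact (hf p' hpX').2.1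
        · rw [h.2]; exact (hg p' hpX').2.1
    have hX := Finset.card_filter_add_card_filter_not (s := X) (fun p => I p l0)
    have c1 : (X.card : ℝ) + 1 ≤ q + A.card * B.card := by
      have : X.card + 1 ≤ q + A.card * B.card := by omega
      exact_mod_cast this
    have c2 : (A.card : ℝ) + B.card + 1 ≤ S.card := by
      have : A.card + B.card + 1 ≤ S.card := by omega
      exact_mod_cast this
    have hx1 : (1 : ℝ) ≤ X.card := by
      have := Finset.card_pos.2 ⟨x0, hx0⟩
      exact_mod_cast this
    exact aux_arith q S.card T.card X.card A.card B.card hqr (by exact_mod_cast hs2) hler hx1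
      (Nat.cast_nonneg _) (Nat.cast_nonneg _) (by linarith) (by linarith) e1 e2 (by linarith)

/-- Let `Π` be a projective plane of order `q`, let `(X, Y)` be an
equinumerous incidence-free pair of points and lines, and set `t := q² + q + 1 − |X|`.
Then there are chambers `(P₁, ℓ₁), …, (P_t, ℓ_t)` such that every chamber `(P, ℓ)` of `Π`
satisfies `P = P_i` or `ℓ = ℓ_i` for some `i`. -/
theorem stmt_5 (q : ℕ) (hq : 2 ≤ q) (P L : Type*) [Membership P L]
    [ProjectivePlane P L] [Fintype P] [Fintype L]
    (horder : ProjectivePlane.order P L = q)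
    (X : Set P) (Y : Set L)
    (hfree : ∀ p ∈ X, ∀ l ∈ Y, p ∉ l)
    (hequi : X.ncard = Y.ncard)
    (t : ℕ) (ht : t = q ^ 2 + q + 1 - X.ncard) :
    ∃ (Pt : Fin t → P) (ln : Fin t → L),
      (∀ i : Fin t, Pt i ∈ ln i) ∧
      ∀ (Q : P) (m : L), Q ∈ m → ∃ i : Fin t, Q = Pt i ∨ m = ln i := by
  classical
  have hP : Fintype.card P = q ^ 2 + q + 1 := by
    rw [ProjectivePlane.card_points P L, horder]
  have hL : Fintype.card L = q ^ 2 + q + 1 := by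
    rw [ProjectivePlane.card_lines P L, horder]
  have hdeg : ∀ p : P, (Finset.univ.filter fun l : L => p ∈ l).card = q + 1 := by
    intro p
    rw [← horder, ← ProjectivePlane.lineCount_eq (P := P) (L := L) p, lineCount, Nat.card_eq_fintype_card,
      Fintype.card_subtype]
  have hdeg' : ∀ l : L, (Finset.univ.filter fun p : P => p ∈ l).card = q + 1 := by
    intro l
    rw [← horder, ← ProjectivePlane.pointCount_eq (P := P) (L := L) l, pointCount, Nat.card_eq_fintype_card,
      Fintype.card_subtype]
  have hjoin : ∀ p p' : P, p ≠ p' → ∃ l : L, ∀ m : L, (p ∈ m ∧ p' ∈ m) ↔ m = l := by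
    intro p p' h
    obtain ⟨l, hl, hu⟩ := HasLines.existsUnique_line P L p p' h
    exact ⟨l, fun m => ⟨fun hm => hu m hm, fun hm => hm ▸ hl⟩⟩
  have hmeet : ∀ l l' : L, l ≠ l' → ∃ p : P, ∀ r : P, (r ∈ l ∧ r ∈ l') ↔ r = p := by
    intro p p' h
    obtain ⟨l, hl, hu⟩ := HasPoints.existsUnique_point P L p p' h
    exact ⟨l, fun m => ⟨fun hm => hu m hm, fun hm => hm ▸ hl⟩⟩
  have hXc : X.ncard = X.toFinset.card := Set.ncard_eq_toFinset_card' X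
  have hYc : Y.ncard = Y.toFinset.card := Set.ncard_eq_toFinset_card' Y
  have hXX := Finset.card_add_card_compl X.toFinset
  have hYY := Finset.card_add_card_compl Y.toFinset
  rw [hP] at hXX
  rw [hL] at hYY
  have cX : Fintype.card {p // p ∉ X} = t := by
    rw [Fintype.card_subtype]
    have : (Finset.univ.filter fun p => p ∉ X) = X.toFinsetᶜ := by ext; simp
    rw [this]; omega
  have cY : Fintype.card {l // l ∉ Y} = t := by
    rw [Fintype.card_subtype]
    have : (Finset.univ.filter fun p => p ∉ Y) = Y.toFinsetᶜ := by ext; simp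
    rw [this]; omega
  have hall : ∃ f : {p // p ∉ X} → {l // l ∉ Y}, Function.Injective f ∧
      ∀ p, (p : P) ∈ (f p : L) := by
    refine (Fintype.all_card_le_filter_rel_iff_exists_injective
      (fun (p : {p // p ∉ X}) (l : {l // l ∉ Y}) => (p : P) ∈ (l : L))).1 ?_
    intro S'
    by_contra! hlt
    let U' := (Finset.univ.filter fun b : {l // l ∉ Y} => ∃ a ∈ S', (a : P) ∈ (b : L))
    let S : Finset P := S'.map (Function.Embedding.subtype _)
    let U : Finset L := U'.map (Function.Embedding.subtype _)
    let T : Finset L := U'ᶜ.map (Function.Embedding.subtype _)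
    let W : Finset P := S'ᶜ.map (Function.Embedding.subtype _)
    have kS : S.card = S'.card := Finset.card_map _
    have kU : U.card = U'.card := Finset.card_map _
    have kT : T.card = U'ᶜ.card := Finset.card_map _
    have kW : W.card = S'ᶜ.card := Finset.card_map _
    have hlt' : U'.card < S'.card := hlt
    have m1 := Finset.card_add_card_compl S'
    have m2 := Finset.card_add_card_compl U'
    rw [cX] at m1
    rw [cY] at m2
    have hXY : ∀ p ∈ X.toFinset, ∀ l ∈ Y.toFinset, ¬ p ∈ l := by
      intro p hp l hl
      exact hfree p (by simpa using hp) l (by simpa using hl)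
    have hST : ∀ p ∈ S, ∀ l ∈ T, ¬ p ∈ l := by
      intro p hp l hl hpl
      obtain ⟨p', hp', rfl⟩ := Finset.mem_map.1 hp
      obtain ⟨l', hl', rfl⟩ := Finset.mem_map.1 hl
      rw [Finset.mem_compl] at hl'
      exact hl' (Finset.mem_filter.2 ⟨Finset.mem_univ _, p', hp', hpl⟩)
    rcases le_total S.card T.card with h | h
    · refine aux_main (fun (p : P) (l : L) => p ∈ l) q hq hjoin hmeet hdeg hdeg' hL
        X.toFinset S Y.toFinset U T hXY hST ?_ ?_ (by omega) (by omega) (by omega) h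
      · rw [Finset.disjoint_right]
        intro p hp
        obtain ⟨p', hp', rfl⟩ := Finset.mem_map.1 hp
        simpa using p'.2
      · intro l
        by_cases hl : l ∈ Y
        · left; simpa using hl
        · right
          by_cases hu : (⟨l, hl⟩ : {l // l ∉ Y}) ∈ U'
          · right; exact Finset.mem_map.2 ⟨_, hu, rfl⟩
          · left; exact Finset.mem_map.2 ⟨_, Finset.mem_compl.2 hu, rfl⟩
    · refine aux_main (fun (l : L) (p : P) => p ∈ l) q hq hmeet hjoin hdeg' hdeg hP
        Y.toFinset T X.toFinset W S (fun l hl p hp => hXY p hp l hl)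
        (fun l hl p hp => hST p hp l hl) ?_ ?_ (by omega) (by omega) (by omega) h
      · rw [Finset.disjoint_right]
        intro p hp
        obtain ⟨p', hp', rfl⟩ := Finset.mem_map.1 hp
        simpa using p'.2
      · intro l
        by_cases hl : l ∈ X
        · left; simpa using hl
        · right
          by_cases hu : (⟨l, hl⟩ : {l // l ∉ X}) ∈ S'
          · left; exact Finset.mem_map.2 ⟨_, hu, rfl⟩
          · right; exact Finset.mem_map.2 ⟨_, Finset.mem_compl.2 hu, rfl⟩
  obtain ⟨f, hf, hfI⟩ := hall
  have hbij : Function.Bijective f :=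
    (Fintype.bijective_iff_injective_and_card f).2 ⟨hf, cX.trans cY.symm⟩
  let e := (Fintype.equivFinOfCardEq cX).symm
  refine ⟨fun i => (e i : P), fun i => (f (e i) : L), fun i => hfI _, ?_⟩
  intro Q m hQ
  by_cases hQX : Q ∈ X
  · have hm : m ∉ Y := fun hm => hfree Q hQX m hm hQ
    obtain ⟨p, hp⟩ := hbij.2 ⟨m, hm⟩
    exact ⟨e.symm p, Or.inr (by simp [hp])⟩
  · exact ⟨e.symm ⟨Q, hQX⟩, Or.inl (by simp)⟩
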